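/- (Correctness of Ukkonen's open-edge / Type-1 suffix handling.) Let T' = (T_1, …, T_K) be a collection, a ∈ Σ, 1 ≤ k ≤ K, and let T be the collection obtained from T' by replacing T_k with T_k·[a]. If s is a nonempty suffix of T_k with exactly one occurrence in T' (|Epos_{T'}(s)| = 1), then s·[a] is a suffix of T_k·[a] with exactly one occurrence in T (|Epos_T(s·[a])| = 1). That is, non-repeating suffixes remain non-repeating after extension, so leaves of the suffix tree remain leaves. -/

import Mathlib

/-- The set of ending positions of occurrences of the nonempty string `x`
in the collection `T = (T_1, …, T_K)`. -/
def Epos {α : Type*} {K : ℕ} (T : Fin K → List α) (x : List α) : Set (Fin K × ℕ) :=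
  {p | x.length ≤ p.2 ∧ p.2 ≤ (T p.1).length ∧
       ((T p.1).take p.2).drop (p.2 - x.length) = x}

theorem mem_Epos_iff {α : Type*} {K : ℕ} (T : Fin K → List α) (x : List α) (i : Fin K) (j : ℕ) :
    (i, j) ∈ Epos T x ↔ ∃ u v, T i = u ++ x ++ v ∧ j = (u ++ x).length := by
  constructor
  · rintro ⟨h1, h2, h3⟩
    simp only at h1 h2 h3
    refine ⟨((T i).take j).take (j - x.length), (T i).drop j, ?_, ?_⟩
    · have h := List.take_append_drop (j - x.length) ((T i).take j)
      rw [h3] at h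
      rw [h, List.take_append_drop]
    · simp only [List.length_append, List.length_take]
      omega
  · rintro ⟨u, v, h, rfl⟩
    refine ⟨by simp, by simp [h], ?_⟩
    simp only [h, List.take_left]
    simp

/-- correctness of open-edge / Type-1 suffix handling:
non-repeating suffixes remain non-repeating after appending a character. -/
theorem type1_suffixes_stay_leaves {α : Type*} {K : ℕ}
    (T' : Fin K → List α) (a : α) (k : Fin K)
    (T : Fin K → List α) (hT : T = Function.update T' k (T' k ++ [a]))
    (s : List α) (hs : s ≠ []) (hsuf : s <:+ T' k)
    (honce : (Epos T' s).ncard = 1) :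
    s ++ [a] <:+ T' k ++ [a] ∧ (Epos T (s ++ [a])).ncard = 1 := by
  have hk : (k, (T' k).length) ∈ Epos T' s := by
    obtain ⟨u, hu⟩ := hsuf
    exact (mem_Epos_iff _ _ _ _).2 ⟨u, [], by simp [hu], by rw [hu]⟩
  obtain ⟨q, hq⟩ := Set.ncard_eq_one.1 honce
  have huniq : ∀ p ∈ Epos T' s, p = (k, (T' k).length) := by
    intro p hp
    rw [hq] at hp hk
    rw [Set.mem_singleton_iff] at hp hk
    rw [hp, hk]
  have hsuf' : s ++ [a] <:+ T' k ++ [a] := by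
    obtain ⟨u, hu⟩ := hsuf
    exact ⟨u, by rw [← hu]; simp⟩
  refine ⟨hsuf', Set.ncard_eq_one.2 ⟨(k, (T' k).length + 1), ?_⟩⟩
  ext ⟨i, j⟩
  rw [Set.mem_singleton_iff]
  constructor
  · intro h
    obtain ⟨u, v, h1, h2⟩ := (mem_Epos_iff _ _ _ _).1 h
    have hmem : (i, (u ++ s).length) ∈ Epos T' s := by
      rw [mem_Epos_iff]
      by_cases hik : i = k
      · subst hik
        simp only [hT, Function.update_self] at h1
        rcases List.eq_nil_or_concat v with rfl | ⟨w, b, rfl⟩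
        · refine ⟨u, [], ?_, rfl⟩
          have : T' i ++ [a] = (u ++ s) ++ [a] := by simpa using h1
          simpa using List.append_cancel_right this
        · refine ⟨u, a :: w, ?_, rfl⟩
          have : T' i ++ [a] = (u ++ s ++ a :: w) ++ [b] := by simpa using h1
          exact (List.append_inj' this rfl).1
      · rw [hT, Function.update_of_ne hik] at h1
        exact ⟨u, a :: v, by simpa using h1, rfl⟩
    have := huniq _ hmem
    simp only [Prod.mk.injEq] at this
    rw [Prod.mk.injEq]
    refine ⟨this.1, ?_⟩
    rw [h2, ← this.2]
    simp [Nat.add_assoc]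
  · intro h
    rw [Prod.mk.injEq] at h
    obtain ⟨rfl, rfl⟩ := h
    obtain ⟨u, hu⟩ := hsuf'
    exact (mem_Epos_iff _ _ _ _).2 ⟨u, [], by simp [hT, ← hu], by rw [hu]; simp⟩
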